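/- arXiv:1812.06608 — 2 statements merged into one kernel-verified Lean document; each statement's English description precedes it below -/
import Mathlib

section
/- Let Φ be a Young function and u a submultiplicative weight on ℝⁿ with sup_{v ∈ ℝⁿ} u(v) < ∞. If f ∈ L_Φ^u(ℝⁿ) satisfies f(y) ≠ 0 for every y ∈ ℝⁿ, then there exists a constant C > 0 (depending on f) such that u(x)/C ≤ ‖T_x f‖_{L_Φ^u} ≤ C u(x) for all x ∈ ℝⁿ, where T_x f(y) = f(y − x). -/
open MeasureTheory Filter
open scoped ENNReal

/-- A Young function: a convex function `Φ : [0,∞) → [0,∞)` (modelled on `ℝ`, with the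
conditions imposed on `Set.Ici 0`) which is left-continuous, vanishes at `0`, tends to `0`
at `0⁺`, and tends to `∞` at `∞`. -/
structure IsYoungFunction (Φ : ℝ → ℝ) : Prop where
  convexOn : ConvexOn ℝ (Set.Ici 0) Φ
  map_zero : Φ 0 = 0
  nonneg : ∀ t, 0 ≤ t → 0 ≤ Φ t
  leftContinuous : ∀ t, 0 < t → ContinuousWithinAt Φ (Set.Iic t) t
  tendsto_zero : Tendsto Φ (nhdsWithin 0 (Set.Ioi 0)) (nhds 0)
  tendsto_atTop : Tendsto Φ atTop atTop

/-- Generalized inverse `Φ⁻¹(s) = inf {r ≥ 0 : Φ r > s}`. -/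
noncomputable def youngInv (Φ : ℝ → ℝ) (s : ℝ) : ℝ :=
  sInf {r : ℝ | 0 ≤ r ∧ s < Φ r}

/-- Weighted Orlicz (Luxemburg) norm, restricted to a measurable set `X ⊆ ℝⁿ`, valued in
`ℝ≥0∞` (with value `∞` if no admissible `b` exists):
`‖f‖ = inf {b > 0 : ∫_X Φ(|u x * f x| / b) dx ≤ 1}`. -/
noncomputable def orliczNormOn {n : ℕ} (Φ : ℝ → ℝ)
    (u f : EuclideanSpace ℝ (Fin n) → ℝ) (X : Set (EuclideanSpace ℝ (Fin n))) : ℝ≥0∞ :=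
  sInf {b : ℝ≥0∞ | 0 < b ∧ b < ⊤ ∧
    ∫⁻ x in X, ENNReal.ofReal (Φ (|u x * f x| / b.toReal)) ≤ 1}

/-- Weighted Orlicz (Luxemburg) norm on all of `ℝⁿ`. -/
noncomputable def orliczNorm {n : ℕ} (Φ : ℝ → ℝ)
    (u f : EuclideanSpace ℝ (Fin n) → ℝ) : ℝ≥0∞ :=
  orliczNormOn Φ u f Set.univ

/-- Membership in the weighted Orlicz space over `X`: `f` is measurable and
`∫_X Φ(a * |u x * f x|) dx < ∞` for some `a > 0`. -/
def MemOrliczOn {n : ℕ} (Φ : ℝ → ℝ) (u f : EuclideanSpace ℝ (Fin n) → ℝ)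
    (X : Set (EuclideanSpace ℝ (Fin n))) : Prop :=
  Measurable f ∧ ∃ a : ℝ, 0 < a ∧ ∫⁻ x in X, ENNReal.ofReal (Φ (a * |u x * f x|)) < ⊤

/-- Membership in the weighted Orlicz space `L_Φ^u(ℝⁿ)`. -/
def MemOrlicz {n : ℕ} (Φ : ℝ → ℝ) (u f : EuclideanSpace ℝ (Fin n) → ℝ) : Prop :=
  MemOrliczOn Φ u f Set.univ

/-- A weight on `ℝⁿ`: a measurable, everywhere positive function. -/
def IsWeight {n : ℕ} (u : EuclideanSpace ℝ (Fin n) → ℝ) : Prop :=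
  Measurable u ∧ ∀ x, 0 < u x

/-- A weight on a subset `X` of `ℝⁿ`: measurable and positive on `X`. -/
def IsWeightOn {n : ℕ} (u : EuclideanSpace ℝ (Fin n) → ℝ)
    (X : Set (EuclideanSpace ℝ (Fin n))) : Prop :=
  Measurable u ∧ ∀ x ∈ X, 0 < u x

/-- Weighted weak Orlicz norm, valued in `ℝ≥0∞`:
`‖f‖ = inf {b > 0 : sup_{t>0} Φ(t) · λ({x : |u x * f x| / b > t}) ≤ 1}`. -/
noncomputable def weakOrliczNorm {n : ℕ} (Φ : ℝ → ℝ)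
    (u f : EuclideanSpace ℝ (Fin n) → ℝ) : ℝ≥0∞ :=
  sInf {b : ℝ≥0∞ | 0 < b ∧ b < ⊤ ∧
    ∀ t : ℝ, 0 < t →
      ENNReal.ofReal (Φ t) * volume {x | t < |u x * f x| / b.toReal} ≤ 1}

/-- Membership in the weighted weak Orlicz space `wL_Φ^u(ℝⁿ)`. -/
def MemWeakOrlicz {n : ℕ} (Φ : ℝ → ℝ) (u f : EuclideanSpace ℝ (Fin n) → ℝ) : Prop :=
  Measurable f ∧ weakOrliczNorm Φ u f < ⊤

/-- Weighted Lebesgue "norm" `(∫_X |u x * f x|^p dx)^(1/p)`, valued in `ℝ≥0∞`. -/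
noncomputable def lebNormOn {n : ℕ} (p : ℝ)
    (u f : EuclideanSpace ℝ (Fin n) → ℝ) (X : Set (EuclideanSpace ℝ (Fin n))) : ℝ≥0∞ :=
  (∫⁻ x in X, ENNReal.ofReal (|u x * f x| ^ p)) ^ (1 / p)

/-- Membership in the weighted Lebesgue space `L_p^u(X)`. -/
def MemLebOn {n : ℕ} (p : ℝ) (u f : EuclideanSpace ℝ (Fin n) → ℝ)
    (X : Set (EuclideanSpace ℝ (Fin n))) : Prop :=
  Measurable f ∧ lebNormOn p u f X < ⊤

namespace IsYoungFunction

variable {Φ : ℝ → ℝ}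

theorem map_mul_le (hΦ : IsYoungFunction Φ) {c t : ℝ} (hc : 0 ≤ c) (hc1 : c ≤ 1) (ht : 0 ≤ t) :
    Φ (c * t) ≤ c * Φ t := by
  have h := hΦ.convexOn.2 (Set.mem_Ici.2 ht) (Set.mem_Ici.2 le_rfl) hc (sub_nonneg.2 hc1)
    (add_sub_cancel c 1)
  simpa [hΦ.map_zero] using h

theorem mono (hΦ : IsYoungFunction Φ) {s t : ℝ} (hs : 0 ≤ s) (hst : s ≤ t) : Φ s ≤ Φ t := by
  rcases hs.eq_or_lt with rfl | hs
  · rw [hΦ.map_zero]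
    exact hΦ.nonneg t hst
  · have ht : 0 < t := hs.trans_le hst
    have h := hΦ.map_mul_le (div_nonneg hs.le ht.le) ((div_le_one ht).2 hst) ht.le
    rw [div_mul_cancel₀ _ ht.ne'] at h
    exact h.trans (mul_le_of_le_one_left (hΦ.nonneg t ht.le) ((div_le_one ht).2 hst))

/-- A function with a finite modular at some scale has modular at most `1` at a smaller scale. -/
theorem exists_lintegral_div_le_one {α : Type*} [MeasurableSpace α] {μ : Measure α}
    (hΦ : IsYoungFunction Φ) {g : α → ℝ} (hg : ∀ x, 0 ≤ g x) {a : ℝ} (ha : 0 < a)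
    (hfin : ∫⁻ x, ENNReal.ofReal (Φ (a * g x)) ∂μ < ⊤) :
    ∃ B : ℝ, 0 < B ∧ ∫⁻ x, ENNReal.ofReal (Φ (g x / B)) ∂μ ≤ 1 := by
  set I := ∫⁻ x, ENNReal.ofReal (Φ (a * g x)) ∂μ with hI
  set r := max 1 I.toReal with hr
  have hr1 : 1 ≤ r := le_max_left _ _
  have hr0 : 0 < r := one_pos.trans_le hr1
  refine ⟨r / a, by positivity, ?_⟩
  calc ∫⁻ x, ENNReal.ofReal (Φ (g x / (r / a))) ∂μ
      ≤ ∫⁻ x, ENNReal.ofReal r⁻¹ * ENNReal.ofReal (Φ (a * g x)) ∂μ := by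
        refine lintegral_mono fun x => ?_
        rw [← ENNReal.ofReal_mul (by positivity)]
        refine ENNReal.ofReal_le_ofReal ?_
        have h := hΦ.map_mul_le (inv_nonneg.2 hr0.le) (inv_le_one_of_one_le₀ hr1)
          (mul_nonneg ha.le (hg x))
        convert h using 2
        field_simp
    _ = ENNReal.ofReal r⁻¹ * I := lintegral_const_mul' _ _ ENNReal.ofReal_ne_top
    _ = ENNReal.ofReal (r⁻¹ * I.toReal) := by
        rw [ENNReal.ofReal_mul (by positivity), ENNReal.ofReal_toReal hfin.ne]
    _ ≤ 1 := by
        rw [ENNReal.ofReal_le_one, inv_mul_le_iff₀ hr0, mul_one]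
        exact le_max_right _ _

/-- If `g` is positive everywhere, the scales `s` for which `s * g` has modular at most `1`
are bounded. -/
theorem exists_forall_le_of_lintegral_le_one {α : Type*} [MeasurableSpace α] {μ : Measure α}
    (hμ : μ ≠ 0) (hΦ : IsYoungFunction Φ) {g : α → ℝ} (hgm : Measurable g) (hg : ∀ x, 0 < g x) :
    ∃ K : ℝ, 0 < K ∧ ∀ s : ℝ, ∫⁻ x, ENNReal.ofReal (Φ (s * g x)) ∂μ ≤ 1 → s ≤ K := by
  obtain ⟨k, hk⟩ : ∃ k : ℕ, μ {x | 1 / ((k : ℝ) + 1) < g x} ≠ 0 := by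
    by_contra! h
    refine hμ (Measure.measure_univ_eq_zero.1 ?_)
    have hU : (⋃ k : ℕ, {x | 1 / ((k : ℝ) + 1) < g x}) = Set.univ :=
      Set.eq_univ_of_forall fun x => Set.mem_iUnion.2 (exists_nat_one_div_lt (hg x))
    rw [← hU]
    exact measure_iUnion_null h
  set ε : ℝ := 1 / ((k : ℝ) + 1) with hε
  have hε0 : 0 < ε := by positivity
  set E := {x | ε < g x} with hE
  have hEm : MeasurableSet E := measurableSet_lt measurable_const hgm
  have hlim : Tendsto (fun t => ENNReal.ofReal (Φ t) * μ E) atTop (nhds ⊤) := by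
    have h := ENNReal.Tendsto.mul_const (b := μ E)
      (ENNReal.tendsto_ofReal_atTop.comp hΦ.tendsto_atTop) (Or.inl ENNReal.top_ne_zero)
    rwa [ENNReal.top_mul hk] at h
  obtain ⟨L, hL1, hL0⟩ := ((hlim.eventually (lt_mem_nhds ENNReal.one_lt_top)).and
    (eventually_gt_atTop 0)).exists
  refine ⟨L / ε, by positivity, fun s hs => ?_⟩
  by_contra! hlt
  refine (hL1.trans_le ?_).not_ge hs
  rw [← lintegral_indicator_const hEm]
  refine lintegral_mono (Set.indicator_le fun x hx => ?_)
  have hsε : L < s * ε := (div_lt_iff₀ hε0).1 hlt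
  have hs0 : 0 < s := (by positivity : (0 : ℝ) < L / ε).trans hlt
  exact ENNReal.ofReal_le_ofReal (hΦ.mono hL0.le
    (hsε.le.trans (mul_le_mul_of_nonneg_left (le_of_lt hx) hs0.le)))

end IsYoungFunction

theorem lintegral_modular_translate {n : ℕ} (Φ : ℝ → ℝ) (u f : EuclideanSpace ℝ (Fin n) → ℝ)
    (x : EuclideanSpace ℝ (Fin n)) (b : ℝ) :
    ∫⁻ y, ENNReal.ofReal (Φ (|u y * f (y - x)| / b)) =
      ∫⁻ z, ENNReal.ofReal (Φ (|u (z + x) * f z| / b)) := by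
  simpa using (lintegral_add_right_eq_self
    (μ := (volume : Measure (EuclideanSpace ℝ (Fin n))))
    (fun y => ENNReal.ofReal (Φ (|u y * f (y - x)| / b))) x).symm

/-- for a bounded submultiplicative weight `u` and a nowhere-vanishing
`f ∈ L_Φ^u(ℝⁿ)`, there is `C > 0` with `u(x)/C ≤ ‖T_x f‖_{L_Φ^u} ≤ C u(x)` for all `x`. -/
theorem stmt8 {n : ℕ} (Φ : ℝ → ℝ) (hΦ : IsYoungFunction Φ)
    (u : EuclideanSpace ℝ (Fin n) → ℝ) (hu : IsWeight u)
    (hsub : ∀ x y : EuclideanSpace ℝ (Fin n), u (x + y) ≤ u x * u y)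
    (hbdd : ∃ M : ℝ, ∀ v : EuclideanSpace ℝ (Fin n), u v ≤ M)
    (f : EuclideanSpace ℝ (Fin n) → ℝ) (hf : MemOrlicz Φ u f)
    (hne : ∀ y : EuclideanSpace ℝ (Fin n), f y ≠ 0) :
    ∃ C : ℝ, 0 < C ∧ ∀ x : EuclideanSpace ℝ (Fin n),
      ENNReal.ofReal (u x / C) ≤ orliczNorm Φ u (fun y => f (y - x)) ∧
      orliczNorm Φ u (fun y => f (y - x)) ≤ ENNReal.ofReal (C * u x) := by
  obtain ⟨hfm, a, ha, hfin⟩ := hf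
  obtain ⟨M, hM⟩ := hbdd
  have hM0 : 0 < M := (hu.2 0).trans_le (hM 0)
  rw [Measure.restrict_univ] at hfin
  obtain ⟨B, hB0, hB⟩ := hΦ.exists_lintegral_div_le_one (fun x => abs_nonneg (u x * f x)) ha hfin
  obtain ⟨K, hK0, hK⟩ := hΦ.exists_forall_le_of_lintegral_le_one
    (NeZero.ne (volume : Measure (EuclideanSpace ℝ (Fin n)))) hfm.abs
    (fun x => abs_pos.2 (hne x))
  refine ⟨max B (M * K), lt_max_of_lt_left hB0, fun x => ?_⟩
  have hux := hu.2 x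
  simp only [orliczNorm, orliczNormOn, Measure.restrict_univ]
  constructor
  · refine le_sInf fun b ⟨hb0, hbtop, hb⟩ => ?_
    rw [lintegral_modular_translate] at hb
    have hbr : 0 < b.toReal := ENNReal.toReal_pos hb0.ne' hbtop.ne
    have hs : u x / (M * b.toReal) ≤ K := by
      refine hK _ (le_trans (lintegral_mono fun z => ENNReal.ofReal_le_ofReal
        (hΦ.mono (by positivity) ?_)) hb)
      have hle : u x ≤ M * u (z + x) := by
        calc u x = u (-z + (z + x)) := by rw [neg_add_cancel_left]
          _ ≤ u (-z) * u (z + x) := hsub _ _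
          _ ≤ M * u (z + x) := mul_le_mul_of_nonneg_right (hM _) (hu.2 _).le
      rw [abs_mul, abs_of_pos (hu.2 (z + x)), div_mul_eq_mul_div, div_le_div_iff₀ (by positivity) hbr]
      have h := mul_le_mul_of_nonneg_right hle (mul_nonneg (abs_nonneg (f z)) hbr.le)
      linarith
    refine ENNReal.ofReal_le_of_le_toReal ?_
    rw [div_le_iff₀ (by positivity)] at hs
    rw [div_le_iff₀ (lt_max_of_lt_left hB0)]
    calc u x ≤ b.toReal * (M * K) := by linarith
      _ ≤ b.toReal * max B (M * K) := mul_le_mul_of_nonneg_left (le_max_right _ _) hbr.le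
  · refine le_trans (sInf_le (a := ENNReal.ofReal (B * u x))
      ⟨ENNReal.ofReal_pos.2 (by positivity), ENNReal.ofReal_lt_top, ?_⟩)
      (ENNReal.ofReal_le_ofReal (mul_le_mul_of_nonneg_right (le_max_left _ _) hux.le))
    rw [lintegral_modular_translate, ENNReal.toReal_ofReal (by positivity)]
    refine le_trans (lintegral_mono fun z => ENNReal.ofReal_le_ofReal
      (hΦ.mono (by positivity) ?_)) hB
    rw [abs_mul, abs_mul, abs_of_pos (hu.2 (z + x)), abs_of_pos (hu.2 z),
      div_le_div_iff₀ (by positivity) hB0]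
    have h := mul_le_mul_of_nonneg_right (hsub z x) (mul_nonneg (abs_nonneg (f z)) hB0.le)
    linarith
end

section
/- Let Φ₁, Φ₂ be Young functions such that there exists C > 0 with Φ₁(t) ≤ Φ₂(C t) for all t > 0, and let u₁, u₂ be submultiplicative weights on ℝⁿ with sup_{v ∈ ℝⁿ} u₁(v) < ∞ such that there exists g ∈ L_{Φ₂}^{u₂}(ℝⁿ) with g(y) ≠ 0 for every y ∈ ℝⁿ. Then the following are equivalent: (1) there exists C > 0 with u₁(x) ≤ C u₂(x) for all x ∈ ℝⁿ; (2) L_{Φ₂}^{u₂}(ℝⁿ) ⊆ L_{Φ₁}^{u₁}(ℝⁿ); (3) there exists C > 0 such that ‖f‖_{L_{Φ₁}^{u₁}} ≤ C ‖f‖_{L_{Φ₂}^{u₂}} for every f ∈ L_{Φ₂}^{u₂}(ℝⁿ). -/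
open MeasureTheory Filter
open scoped ENNReal

lemma IsYoungFunction.mul_le {Φ : ℝ → ℝ} (h : IsYoungFunction Φ) {c t : ℝ}
    (hc : 0 ≤ c) (hc1 : c ≤ 1) (ht : 0 ≤ t) : Φ (c * t) ≤ c * Φ t := by
  have := h.convexOn.2 (x := t) ht (y := 0) (Set.mem_Ici.2 le_rfl) hc (sub_nonneg.2 hc1) (by ring)
  simpa [h.map_zero] using this

lemma IsYoungFunction.mono_s12 {Φ : ℝ → ℝ} (h : IsYoungFunction Φ) {s t : ℝ}
    (hs : 0 ≤ s) (hst : s ≤ t) : Φ s ≤ Φ t := by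
  rcases hs.eq_or_lt with rfl | hs'
  · rw [h.map_zero]; exact h.nonneg t hst
  have ht : 0 < t := hs'.trans_le hst
  have h1 : s / t ≤ 1 := (div_le_one ht).2 hst
  have h2 := h.mul_le (by positivity) h1 ht.le
  rw [div_mul_cancel₀ _ ht.ne'] at h2
  exact h2.trans (mul_le_of_le_one_left (h.nonneg t ht.le) h1)

lemma IsYoungFunction.measurable_comp {α : Type*} [MeasurableSpace α] {Φ : ℝ → ℝ}
    (h : IsYoungFunction Φ) {f : α → ℝ} (hf : Measurable f) (hf0 : ∀ x, 0 ≤ f x) :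
    Measurable fun x => Φ (f x) := by
  have hmono : Monotone fun t => Φ (max t 0) := fun s t hst =>
    h.mono_s12 (le_max_right _ _) (max_le_max_right _ hst)
  simpa [Function.comp_def, max_eq_left (hf0 _)] using hmono.measurable.comp hf

lemma IsYoungFunction.tendsto_ofReal_mul {Φ : ℝ → ℝ} (h : IsYoungFunction Φ) {m : ℝ≥0∞}
    (hm : m ≠ 0) : Tendsto (fun t => ENNReal.ofReal (Φ t) * m) atTop (nhds ⊤) := by
  have h1 := ENNReal.Tendsto.mul_const (b := m)
    (ENNReal.tendsto_ofReal_atTop.comp h.tendsto_atTop) (Or.inl ENNReal.top_ne_zero)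
  rwa [ENNReal.top_mul hm] at h1

/-- Chebyshev-type lower bound for the modular of a nowhere vanishing function. -/
lemma exists_young_modular_lower_bound {α : Type*} [MeasurableSpace α] {μ : Measure α}
    [NeZero μ] {g : α → ℝ} (hg : Measurable g) (hg0 : ∀ y, g y ≠ 0) :
    ∃ ε : ℝ, 0 < ε ∧ ∃ m : ℝ≥0∞, m ≠ 0 ∧ ∀ Φ : ℝ → ℝ, IsYoungFunction Φ → ∀ s : ℝ, 0 ≤ s →
      ENNReal.ofReal (Φ (s * ε)) * m ≤ ∫⁻ y, ENNReal.ofReal (Φ (s * |g y|)) ∂μ := by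
  have hcover : (⋃ k : ℕ, {y | 1 / ((k : ℝ) + 1) ≤ |g y|}) = Set.univ := by
    refine Set.eq_univ_of_forall fun y => ?_
    obtain ⟨k, hk⟩ := exists_nat_one_div_lt (abs_pos.2 (hg0 y))
    exact Set.mem_iUnion.2 ⟨k, hk.le⟩
  have hk : ∃ k : ℕ, μ {y | 1 / ((k : ℝ) + 1) ≤ |g y|} ≠ 0 := by
    by_contra! hall
    have := measure_iUnion_null hall
    rw [hcover] at this
    exact NeZero.ne μ (Measure.measure_univ_eq_zero.1 this)
  obtain ⟨k, hk⟩ := hk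
  refine ⟨1 / ((k : ℝ) + 1), by positivity, _, hk, fun Φ hΦ s hs => ?_⟩
  have hmeas : MeasurableSet {y | 1 / ((k : ℝ) + 1) ≤ |g y|} :=
    measurableSet_le measurable_const (by simpa using hg.norm)
  rw [← setLIntegral_const]
  refine (setLIntegral_mono' hmeas fun y hy => ?_).trans (setLIntegral_le_lintegral _ _)
  exact ENNReal.ofReal_le_ofReal
    (hΦ.mono_s12 (by positivity) (mul_le_mul_of_nonneg_left hy hs))

lemma MemOrlicz.exists_modular_le_one {n : ℕ} {Φ : ℝ → ℝ} (h : IsYoungFunction Φ)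
    {u g : EuclideanSpace ℝ (Fin n) → ℝ} (hg : MemOrlicz Φ u g) :
    ∃ a : ℝ, 0 < a ∧ ∫⁻ x, ENNReal.ofReal (Φ (a * |u x * g x|)) ≤ 1 := by
  obtain ⟨-, a, ha, hI⟩ := hg
  rw [Measure.restrict_univ] at hI
  set I := ∫⁻ x, ENNReal.ofReal (Φ (a * |u x * g x|)) with hIdef
  set c : ℝ := 1 / (1 + I.toReal) with hc
  have hc0 : 0 < c := by positivity
  have hc1 : c ≤ 1 := by
    rw [hc, div_le_one (by positivity)]; linarith [ENNReal.toReal_nonneg (a := I)]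
  refine ⟨c * a, by positivity, ?_⟩
  calc ∫⁻ x, ENNReal.ofReal (Φ (c * a * |u x * g x|))
      ≤ ∫⁻ x, ENNReal.ofReal c * ENNReal.ofReal (Φ (a * |u x * g x|)) := by
        refine lintegral_mono fun x => ?_
        dsimp only
        rw [← ENNReal.ofReal_mul hc0.le, mul_assoc]
        exact ENNReal.ofReal_le_ofReal (h.mul_le hc0.le hc1 (by positivity))
    _ = ENNReal.ofReal c * I := lintegral_const_mul' _ _ ENNReal.ofReal_ne_top
    _ = ENNReal.ofReal (c * I.toReal) := by
        rw [ENNReal.ofReal_mul hc0.le, ENNReal.ofReal_toReal hI.ne]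
    _ ≤ 1 := by
        rw [ENNReal.ofReal_le_one, hc, div_mul_eq_mul_div, one_mul, div_le_one (by positivity)]
        linarith

/-- Pointwise bound behind the estimate of a translate in a submultiplicatively weighted space. -/
lemma abs_weight_mul_translate_le {n : ℕ} {u : EuclideanSpace ℝ (Fin n) → ℝ} (hu : IsWeight u)
    (hsub : ∀ x y, u (x + y) ≤ u x * u y) (g : EuclideanSpace ℝ (Fin n) → ℝ)
    (x y : EuclideanSpace ℝ (Fin n)) :
    |u y * g (y - x)| ≤ u x * |u (y - x) * g (y - x)| := by
  rw [abs_mul, abs_mul, abs_of_pos (hu.2 y), abs_of_pos (hu.2 (y - x)), ← mul_assoc]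
  have := hsub x (y - x)
  rw [add_sub_cancel] at this
  gcongr

lemma modular_le_of_weight_le {n : ℕ} {Φ₁ Φ₂ : ℝ → ℝ} (h₁ : IsYoungFunction Φ₁)
    (h₂ : IsYoungFunction Φ₂) {C : ℝ} (hC : 0 < C)
    (hΦ : ∀ t : ℝ, 0 < t → Φ₁ t ≤ Φ₂ (C * t))
    {u₁ u₂ : EuclideanSpace ℝ (Fin n) → ℝ} (hu₁ : IsWeight u₁) (hu₂ : IsWeight u₂)
    {D : ℝ} (hD : 0 < D) (hu : ∀ x, u₁ x ≤ D * u₂ x)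
    (f : EuclideanSpace ℝ (Fin n) → ℝ) {a : ℝ} (ha : 0 ≤ a) :
    ∫⁻ x, ENNReal.ofReal (Φ₁ (a / (C * D) * |u₁ x * f x|)) ≤
      ∫⁻ x, ENNReal.ofReal (Φ₂ (a * |u₂ x * f x|)) := by
  refine lintegral_mono fun x => ENNReal.ofReal_le_ofReal ?_
  have hle : |u₁ x * f x| ≤ D * |u₂ x * f x| := by
    rw [abs_mul, abs_mul, abs_of_pos (hu₁.2 x), abs_of_pos (hu₂.2 x), ← mul_assoc]
    gcongr
    exact hu x
  have h0 : 0 ≤ a / (C * D) * |u₁ x * f x| := by positivity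
  have hΦ' : Φ₁ (a / (C * D) * |u₁ x * f x|) ≤ Φ₂ (C * (a / (C * D) * |u₁ x * f x|)) := by
    rcases h0.eq_or_lt with h0 | h0
    · rw [← h0, mul_zero, h₁.map_zero, h₂.map_zero]
    · exact hΦ _ h0
  refine hΦ'.trans (h₂.mono_s12 (by positivity) ?_)
  calc C * (a / (C * D) * |u₁ x * f x|) ≤ C * (a / (C * D) * (D * |u₂ x * f x|)) := by gcongr
    _ = a * |u₂ x * f x| := by field_simp

lemma memOrlicz_of_weight_le {n : ℕ} {Φ₁ Φ₂ : ℝ → ℝ} (h₁ : IsYoungFunction Φ₁)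
    (h₂ : IsYoungFunction Φ₂) {C : ℝ} (hC : 0 < C)
    (hΦ : ∀ t : ℝ, 0 < t → Φ₁ t ≤ Φ₂ (C * t))
    {u₁ u₂ : EuclideanSpace ℝ (Fin n) → ℝ} (hu₁ : IsWeight u₁) (hu₂ : IsWeight u₂)
    {D : ℝ} (hD : 0 < D) (hu : ∀ x, u₁ x ≤ D * u₂ x)
    {f : EuclideanSpace ℝ (Fin n) → ℝ} (hf : MemOrlicz Φ₂ u₂ f) : MemOrlicz Φ₁ u₁ f := by
  obtain ⟨hfm, a, ha, hI⟩ := hf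
  refine ⟨hfm, a / (C * D), by positivity, ?_⟩
  rw [Measure.restrict_univ] at hI ⊢
  exact (modular_le_of_weight_le h₁ h₂ hC hΦ hu₁ hu₂ hD hu f ha.le).trans_lt hI

lemma orliczNorm_le_of_weight_le {n : ℕ} {Φ₁ Φ₂ : ℝ → ℝ} (h₁ : IsYoungFunction Φ₁)
    (h₂ : IsYoungFunction Φ₂) {C : ℝ} (hC : 0 < C)
    (hΦ : ∀ t : ℝ, 0 < t → Φ₁ t ≤ Φ₂ (C * t))
    {u₁ u₂ : EuclideanSpace ℝ (Fin n) → ℝ} (hu₁ : IsWeight u₁) (hu₂ : IsWeight u₂)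
    {D : ℝ} (hD : 0 < D) (hu : ∀ x, u₁ x ≤ D * u₂ x)
    (f : EuclideanSpace ℝ (Fin n) → ℝ) :
    orliczNorm Φ₁ u₁ f ≤ ENNReal.ofReal (C * D) * orliczNorm Φ₂ u₂ f := by
  have hCD : 0 < C * D := by positivity
  have hK0 : ENNReal.ofReal (C * D) ≠ 0 := (ENNReal.ofReal_pos.2 hCD).ne'
  rw [mul_comm, ← ENNReal.div_le_iff_le_mul (Or.inl hK0) (Or.inl ENNReal.ofReal_ne_top)]
  refine le_sInf fun b hb => ?_
  obtain ⟨hb0, hbt, hb1⟩ := hb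
  rw [ENNReal.div_le_iff_le_mul (Or.inl hK0) (Or.inl ENNReal.ofReal_ne_top), mul_comm]
  refine sInf_le ⟨ENNReal.mul_pos hK0 hb0.ne', ENNReal.mul_lt_top ENNReal.ofReal_lt_top hbt, ?_⟩
  rw [Measure.restrict_univ] at hb1 ⊢
  have hmod := modular_le_of_weight_le h₁ h₂ hC hΦ hu₁ hu₂ hD hu f
    (a := 1 / b.toReal) (by positivity)
  rw [ENNReal.toReal_mul, ENNReal.toReal_ofReal hCD.le]
  calc _ = _ := lintegral_congr fun x => by
        rw [show |u₁ x * f x| / (C * D * b.toReal) = 1 / b.toReal / (C * D) * |u₁ x * f x| by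
          rw [div_div, one_div, mul_comm b.toReal, div_eq_inv_mul]]
    _ ≤ _ := hmod
    _ = _ := lintegral_congr fun x => by
        rw [show |u₂ x * f x| / b.toReal = 1 / b.toReal * |u₂ x * f x| by
          rw [one_div, div_eq_inv_mul]]
    _ ≤ 1 := hb1

lemma inv_le_of_submultiplicative {n : ℕ} {u : EuclideanSpace ℝ (Fin n) → ℝ}
    (hu : IsWeight u) (hsub : ∀ x y, u (x + y) ≤ u x * u y) {M : ℝ} (hM : ∀ v, u v ≤ M) :
    0 < M ∧ ∀ x, M⁻¹ ≤ u x := by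
  have hM0 : 0 < M := (hu.2 0).trans_le (hM 0)
  refine ⟨hM0, fun x => ?_⟩
  have h0 : 1 ≤ u 0 := by
    have := hsub 0 0
    rw [add_zero] at this
    nlinarith [hu.2 0]
  have h1 : 1 ≤ u x * M := by
    have := hsub x (-x)
    rw [add_neg_cancel] at this
    exact h0.trans (this.trans (mul_le_mul_of_nonneg_left (hM _) (hu.2 x).le))
  rwa [inv_le_iff_one_le_mul₀ hM0]

/-- The modular of any function dominating a translate of `g`, for a weight bounded below. -/
lemma modular_translate_le {n : ℕ} {Φ : ℝ → ℝ} (h : IsYoungFunction Φ)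
    {u : EuclideanSpace ℝ (Fin n) → ℝ} {c : ℝ} (hc : 0 < c) (hu : ∀ x, c ≤ u x)
    {f g : EuclideanSpace ℝ (Fin n) → ℝ} {w : ℝ} (hw : 0 ≤ w) {x : EuclideanSpace ℝ (Fin n)}
    (hfg : ∀ᵐ y, w * |g (y - x)| ≤ |f y|) {a : ℝ} (ha : 0 ≤ a) :
    ∫⁻ y, ENNReal.ofReal (Φ (a * c * w * |g y|)) ≤
      ∫⁻ y, ENNReal.ofReal (Φ (a * |u y * f y|)) := by
  rw [← lintegral_sub_right_eq_self (fun y => ENNReal.ofReal (Φ (a * c * w * |g y|))) x]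
  refine lintegral_mono_ae ?_
  filter_upwards [hfg] with y hy
  refine ENNReal.ofReal_le_ofReal (h.mono_s12 (by positivity) ?_)
  rw [abs_mul, abs_of_pos (hc.trans_le (hu y)), mul_assoc, mul_assoc]
  exact mul_le_mul_of_nonneg_left
    (mul_le_mul (hu y) hy (by positivity) (hc.le.trans (hu y))) ha

lemma weight_le_of_orliczNorm_le {n : ℕ} {Φ₁ Φ₂ : ℝ → ℝ} (h₁ : IsYoungFunction Φ₁)
    (h₂ : IsYoungFunction Φ₂) {u₁ u₂ : EuclideanSpace ℝ (Fin n) → ℝ}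
    (hu₁ : IsWeight u₁) (hu₂ : IsWeight u₂)
    (hsub₁ : ∀ x y, u₁ (x + y) ≤ u₁ x * u₁ y) (hsub₂ : ∀ x y, u₂ (x + y) ≤ u₂ x * u₂ y)
    {M : ℝ} (hM : ∀ v, u₁ v ≤ M) {g : EuclideanSpace ℝ (Fin n) → ℝ} (hg : MemOrlicz Φ₂ u₂ g)
    (hg0 : ∀ y, g y ≠ 0) {C : ℝ} (hC : 0 < C)
    (hnorm : ∀ f : EuclideanSpace ℝ (Fin n) → ℝ, MemOrlicz Φ₂ u₂ f →
        orliczNorm Φ₁ u₁ f ≤ ENNReal.ofReal C * orliczNorm Φ₂ u₂ f) :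
    ∃ D : ℝ, 0 < D ∧ ∀ x, u₁ x ≤ D * u₂ x := by
  obtain ⟨hM0, hlow⟩ := inv_le_of_submultiplicative hu₁ hsub₁ hM
  obtain ⟨ε, hε, m, hm, hbound⟩ := exists_young_modular_lower_bound (μ := volume) hg.1 hg0
  obtain ⟨a, ha, hI⟩ := hg.exists_modular_le_one h₂
  obtain ⟨T, hT0, hT⟩ : ∃ T : ℝ, 0 < T ∧ ∀ t, T ≤ t → 1 < ENNReal.ofReal (Φ₁ t) * m := by
    have := (h₁.tendsto_ofReal_mul hm).eventually (lt_mem_nhds ENNReal.one_lt_top)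
    obtain ⟨T, hT⟩ := eventually_atTop.1 this
    exact ⟨max T 1, by positivity, fun t ht => hT t ((le_max_left _ _).trans ht)⟩
  set c : ℝ := M⁻¹ * ε / T with hc
  have hc0 : 0 < c := by positivity
  have hkey : ∀ x, c ≤ C * (u₂ x / a) := by
    intro x
    have hux := hu₂.2 x
    have hmod : ∫⁻ y, ENNReal.ofReal (Φ₂ (a / u₂ x * |u₂ y * g (y - x)|)) ≤ 1 := by
      refine le_trans ?_ hI
      rw [← lintegral_sub_right_eq_self (fun y => ENNReal.ofReal (Φ₂ (a * |u₂ y * g y|))) x]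
      refine lintegral_mono fun y => ENNReal.ofReal_le_ofReal (h₂.mono_s12 (by positivity) ?_)
      have := abs_weight_mul_translate_le hu₂ hsub₂ g x y
      calc _ ≤ a / u₂ x * (u₂ x * |u₂ (y - x) * g (y - x)|) := by gcongr
        _ = _ := by field_simp
    have hmem : MemOrlicz Φ₂ u₂ (fun y => g (y - x)) := by
      refine ⟨hg.1.comp (measurable_id.sub_const x), a / u₂ x, by positivity, ?_⟩
      rw [Measure.restrict_univ]
      exact hmod.trans_lt ENNReal.one_lt_top
    have hupper : orliczNorm Φ₂ u₂ (fun y => g (y - x)) ≤ ENNReal.ofReal (u₂ x / a) := by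
      refine sInf_le ⟨ENNReal.ofReal_pos.2 (by positivity), ENNReal.ofReal_lt_top, ?_⟩
      rw [Measure.restrict_univ, ENNReal.toReal_ofReal (by positivity)]
      convert hmod using 5
      rw [div_div_eq_mul_div, div_mul_eq_mul_div, mul_comm]
    have hlower : ENNReal.ofReal c ≤ orliczNorm Φ₁ u₁ (fun y => g (y - x)) := by
      refine le_sInf fun b hb => ?_
      obtain ⟨hb0, hbt, hb1⟩ := hb
      have hbpos : 0 < b.toReal := ENNReal.toReal_pos hb0.ne' hbt.ne
      rw [Measure.restrict_univ] at hb1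
      rw [ENNReal.ofReal_le_iff_le_toReal hbt.ne]
      by_contra! hlt
      have h3 := modular_translate_le h₁ (inv_pos.2 hM0) hlow (f := fun y => g (y - x)) (g := g)
        (x := x) zero_le_one (Eventually.of_forall fun y => (one_mul _).le)
        (inv_pos.2 hbpos).le
      have h4 := hbound Φ₁ h₁ (b.toReal⁻¹ * M⁻¹ * 1) (by positivity)
      simp_rw [div_eq_inv_mul] at hb1
      refine absurd ((h4.trans h3).trans hb1) (not_le.2 (hT _ ?_))
      rw [hc, lt_div_iff₀ hT0] at hlt
      rw [mul_one, mul_assoc, ← div_eq_inv_mul, le_div_iff₀ hbpos, mul_comm]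
      exact hlt.le
    have := (hlower.trans (hnorm _ hmem)).trans (mul_le_mul_right hupper _)
    rw [← ENNReal.ofReal_mul hC.le, ENNReal.ofReal_le_ofReal_iff (by positivity)] at this
    exact this
  refine ⟨M * C / (a * c), by positivity, fun x => (hM x).trans ?_⟩
  have := hkey x
  rw [div_mul_eq_mul_div, le_div_iff₀ (by positivity)]
  rw [← mul_div_assoc, le_div_iff₀ ha] at this
  nlinarith

/-- If `u` is arbitrarily small, suitably weighted translates of `g` have a supremum in
`L_Φ^u`. -/
lemma exists_memOrlicz_dominating_translates {n : ℕ} {Φ : ℝ → ℝ} (h : IsYoungFunction Φ)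
    {u : EuclideanSpace ℝ (Fin n) → ℝ} (hu : IsWeight u)
    (hsub : ∀ x y, u (x + y) ≤ u x * u y) {g : EuclideanSpace ℝ (Fin n) → ℝ}
    (hg : MemOrlicz Φ u g) {x : ℕ → EuclideanSpace ℝ (Fin n)}
    (hx : ∀ k, u (x k) ≤ (1 / 4) ^ k) :
    ∃ f, MemOrlicz Φ u f ∧ ∀ k : ℕ, ∀ᵐ y, 2 ^ k * |g (y - x k)| ≤ |f y| := by
  obtain ⟨a, ha, hI⟩ := hg.exists_modular_le_one h
  set t : ℕ → EuclideanSpace ℝ (Fin n) → ℝ := fun k y => 2 ^ k * |g (y - x k)| with ht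
  have ht0 : ∀ k y, 0 ≤ t k y := fun k y => by positivity
  have htm : ∀ k, Measurable (t k) := fun k => by
    have : Measurable fun y => g (y - x k) := hg.1.comp (measurable_id.sub_const _)
    exact measurable_const.mul (by simpa using this.norm)
  set F : ℕ → EuclideanSpace ℝ (Fin n) → ℝ≥0∞ :=
    fun k y => ENNReal.ofReal (Φ (a * (u y * t k y))) with hF
  have hnn : ∀ k y, 0 ≤ a * (u y * t k y) := fun k y =>
    mul_nonneg ha.le (mul_nonneg (hu.2 y).le (ht0 k y))
  have hFm : ∀ k, Measurable (F k) := fun k =>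
    (h.measurable_comp (measurable_const.mul (hu.1.mul (htm k))) (hnn k)).ennreal_ofReal
  have hFI : ∀ k, ∫⁻ y, F k y ≤ (2⁻¹ : ℝ≥0∞) ^ k := by
    intro k
    calc ∫⁻ y, F k y
        ≤ ∫⁻ y, ENNReal.ofReal ((1 / 2) ^ k) *
            ENNReal.ofReal (Φ (a * |u (y - x k) * g (y - x k)|)) := by
          refine lintegral_mono fun y => ?_
          dsimp only [hF]
          rw [← ENNReal.ofReal_mul (by positivity)]
          refine ENNReal.ofReal_le_ofReal (le_trans (h.mono_s12 (hnn k y) ?_)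
            (h.mul_le (by positivity) (pow_le_one₀ (by norm_num) (by norm_num)) (by positivity)))
          have h1 := abs_weight_mul_translate_le hu hsub g (x k) y
          rw [abs_mul, abs_of_pos (hu.2 y)] at h1
          calc a * (u y * t k y) = a * 2 ^ k * (u y * |g (y - x k)|) := by
                simp only [ht]; ring
            _ ≤ a * 2 ^ k * ((1 / 4) ^ k * |u (y - x k) * g (y - x k)|) := by
                have := hx k
                exact mul_le_mul_of_nonneg_left (h1.trans (by gcongr)) (by positivity)
            _ = (2 * (1 / 4)) ^ k * (a * |u (y - x k) * g (y - x k)|) := by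
                rw [mul_pow]; ring
            _ = _ := by norm_num
      _ = ENNReal.ofReal ((1 / 2) ^ k) * ∫⁻ y, ENNReal.ofReal (Φ (a * |u y * g y|)) := by
          rw [lintegral_const_mul' _ _ ENNReal.ofReal_ne_top,
            lintegral_sub_right_eq_self (fun y => ENNReal.ofReal (Φ (a * |u y * g y|))) (x k)]
      _ ≤ ENNReal.ofReal ((1 / 2) ^ k) * 1 := mul_le_mul_right hI _
      _ = (2⁻¹ : ℝ≥0∞) ^ k := by
          rw [mul_one, ENNReal.ofReal_pow (by norm_num), one_div,
            ENNReal.ofReal_inv_of_pos (by norm_num)]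
          simp
  have hsum : ∫⁻ y, ∑' k, F k y < ⊤ := by
    rw [lintegral_tsum fun k => (hFm k).aemeasurable]
    refine (ENNReal.tsum_le_tsum hFI).trans_lt ?_
    rw [ENNReal.tsum_geometric, ENNReal.one_sub_inv_two, inv_inv]
    exact ENNReal.ofNat_lt_top
  have hbdd : ∀ᵐ y, BddAbove (Set.range fun k => t k y) := by
    filter_upwards [ae_lt_top (Measurable.tsum hFm) hsum.ne] with y hy
    obtain ⟨T, hT⟩ := eventually_atTop.1 (h.tendsto_atTop.eventually_gt_atTop (∑' k, F k y).toReal)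
    refine ⟨T / (a * u y), ?_⟩
    rintro _ ⟨k, rfl⟩
    have huy := hu.2 y
    rw [le_div_iff₀ (by positivity)]
    by_contra! hlt
    have h1 := hT (a * (u y * t k y)) (by linarith)
    have h2 : Φ (a * (u y * t k y)) ≤ (∑' k, F k y).toReal :=
      (ENNReal.ofReal_le_iff_le_toReal hy.ne).1 (ENNReal.le_tsum k)
    exact absurd h1 (not_lt.2 h2)
  have hf0 : ∀ y, 0 ≤ ⨆ k, t k y := fun y => Real.iSup_nonneg fun k => ht0 k y
  refine ⟨fun y => ⨆ k, t k y, ⟨Measurable.iSup htm, a / 2, by positivity, ?_⟩, fun k => ?_⟩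
  · rw [Measure.restrict_univ]
    refine (lintegral_mono fun y => ?_).trans_lt hsum
    dsimp only
    rw [abs_of_nonneg (mul_nonneg (hu.2 y).le (hf0 y))]
    rcases (hf0 y).eq_or_lt with h0 | h0
    · rw [← h0, mul_zero, mul_zero, h.map_zero, ENNReal.ofReal_zero]
      exact zero_le
    · obtain ⟨k, hk⟩ := exists_lt_of_lt_ciSup (half_lt_self h0)
      have huy := hu.2 y
      refine le_trans (ENNReal.ofReal_le_ofReal (h.mono_s12 ?_ ?_)) (ENNReal.le_tsum k)
      · positivity
      · calc a / 2 * (u y * ⨆ k, t k y) = a * (u y * ((⨆ k, t k y) / 2)) := by ring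
          _ ≤ _ := by gcongr
  · filter_upwards [hbdd] with y hy
    rw [abs_of_nonneg (hf0 y)]
    exact le_ciSup hy k

lemma weight_le_of_memOrlicz_imp {n : ℕ} {Φ₁ Φ₂ : ℝ → ℝ} (h₁ : IsYoungFunction Φ₁)
    (h₂ : IsYoungFunction Φ₂) {u₁ u₂ : EuclideanSpace ℝ (Fin n) → ℝ}
    (hu₁ : IsWeight u₁) (hu₂ : IsWeight u₂)
    (hsub₁ : ∀ x y, u₁ (x + y) ≤ u₁ x * u₁ y) (hsub₂ : ∀ x y, u₂ (x + y) ≤ u₂ x * u₂ y)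
    {M : ℝ} (hM : ∀ v, u₁ v ≤ M) {g : EuclideanSpace ℝ (Fin n) → ℝ} (hg : MemOrlicz Φ₂ u₂ g)
    (hg0 : ∀ y, g y ≠ 0)
    (hsubset : ∀ f : EuclideanSpace ℝ (Fin n) → ℝ, MemOrlicz Φ₂ u₂ f → MemOrlicz Φ₁ u₁ f) :
    ∃ D : ℝ, 0 < D ∧ ∀ x, u₁ x ≤ D * u₂ x := by
  obtain ⟨hM0, hlow⟩ := inv_le_of_submultiplicative hu₁ hsub₁ hM
  obtain ⟨ε, hε, m, hm, hbound⟩ := exists_young_modular_lower_bound (μ := volume) hg.1 hg0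
  by_contra! hcon
  have hsmall : ∀ k : ℕ, ∃ x, u₂ x ≤ (1 / 4) ^ k := by
    intro k
    obtain ⟨x, hx⟩ := hcon (M * 4 ^ k) (by positivity)
    refine ⟨x, ?_⟩
    have h1 : M * (4 ^ k * u₂ x) ≤ M * 1 := by
      rw [← mul_assoc, mul_one]; exact hx.le.trans (hM x)
    rw [one_div, inv_pow, ← one_div, le_div_iff₀ (by positivity), mul_comm]
    exact le_of_mul_le_mul_left h1 hM0
  choose x hx using hsmall
  obtain ⟨f, hf, hdom⟩ := exists_memOrlicz_dominating_translates h₂ hu₂ hsub₂ hg hx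
  obtain ⟨-, a, ha, hI⟩ := hsubset f hf
  rw [Measure.restrict_univ] at hI
  have hle : ∀ k : ℕ, ENNReal.ofReal (Φ₁ (a * M⁻¹ * 2 ^ k * ε)) * m ≤
      ∫⁻ y, ENNReal.ofReal (Φ₁ (a * |u₁ y * f y|)) := fun k =>
    (hbound Φ₁ h₁ _ (by positivity)).trans
      (modular_translate_le h₁ (inv_pos.2 hM0) hlow (by positivity) (hdom k) ha.le)
  have htend : Tendsto (fun k : ℕ => a * M⁻¹ * (2 : ℝ) ^ k * ε) atTop atTop :=
    ((tendsto_pow_atTop_atTop_of_one_lt one_lt_two).const_mul_atTop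
      (mul_pos ha (inv_pos.2 hM0))).atTop_mul_const hε
  have := le_of_tendsto' ((h₁.tendsto_ofReal_mul hm).comp htend) hle
  exact hI.not_ge this

/-- with `Φ₁ ≺ Φ₂`, submultiplicative weights, `u₁` bounded, and a
nowhere-vanishing `g ∈ L_{Φ₂}^{u₂}(ℝⁿ)`, equivalence of (1) `u₁ ⪯ u₂`,
(2) `L_{Φ₂}^{u₂} ⊆ L_{Φ₁}^{u₁}`, and (3) the norm inequality. -/
theorem stmt12 {n : ℕ} (Φ₁ Φ₂ : ℝ → ℝ)
    (h₁ : IsYoungFunction Φ₁) (h₂ : IsYoungFunction Φ₂)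
    (hΦ : ∃ C : ℝ, 0 < C ∧ ∀ t : ℝ, 0 < t → Φ₁ t ≤ Φ₂ (C * t))
    (u₁ u₂ : EuclideanSpace ℝ (Fin n) → ℝ) (hu₁ : IsWeight u₁) (hu₂ : IsWeight u₂)
    (hsub₁ : ∀ x y : EuclideanSpace ℝ (Fin n), u₁ (x + y) ≤ u₁ x * u₁ y)
    (hsub₂ : ∀ x y : EuclideanSpace ℝ (Fin n), u₂ (x + y) ≤ u₂ x * u₂ y)
    (hbdd : ∃ M : ℝ, ∀ v : EuclideanSpace ℝ (Fin n), u₁ v ≤ M)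
    (hg : ∃ g : EuclideanSpace ℝ (Fin n) → ℝ, MemOrlicz Φ₂ u₂ g ∧
      ∀ y : EuclideanSpace ℝ (Fin n), g y ≠ 0) :
    ((∃ C : ℝ, 0 < C ∧ ∀ x : EuclideanSpace ℝ (Fin n), u₁ x ≤ C * u₂ x) ↔
      (∀ f : EuclideanSpace ℝ (Fin n) → ℝ, MemOrlicz Φ₂ u₂ f → MemOrlicz Φ₁ u₁ f)) ∧
    ((∃ C : ℝ, 0 < C ∧ ∀ x : EuclideanSpace ℝ (Fin n), u₁ x ≤ C * u₂ x) ↔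
      (∃ C : ℝ, 0 < C ∧ ∀ f : EuclideanSpace ℝ (Fin n) → ℝ, MemOrlicz Φ₂ u₂ f →
        orliczNorm Φ₁ u₁ f ≤ ENNReal.ofReal C * orliczNorm Φ₂ u₂ f)) := by
  obtain ⟨C, hC, hΦ⟩ := hΦ
  obtain ⟨M, hM⟩ := hbdd
  obtain ⟨g, hg, hg0⟩ := hg
  refine ⟨⟨?_, ?_⟩, ⟨?_, ?_⟩⟩
  · rintro ⟨D, hD, hu⟩ f hf
    exact memOrlicz_of_weight_le h₁ h₂ hC hΦ hu₁ hu₂ hD hu hf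
  · exact weight_le_of_memOrlicz_imp h₁ h₂ hu₁ hu₂ hsub₁ hsub₂ hM hg hg0
  · rintro ⟨D, hD, hu⟩
    exact ⟨C * D, by positivity, fun f _ =>
      orliczNorm_le_of_weight_le h₁ h₂ hC hΦ hu₁ hu₂ hD hu f⟩
  · rintro ⟨K, hK, hnorm⟩
    exact weight_le_of_orliczNorm_le h₁ h₂ hu₁ hu₂ hsub₁ hsub₂ hM hg hg0 hK hnorm
end
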